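/- arXiv:2401.14702 — 3 statements merged into one kernel-verified Lean document; each statement's English description precedes it below -/
import Mathlib

section
/- Let V be a finite set of n nodes partitioned into two groups V_a and V_{≠a} (both nonempty) by a binary indicator, with each node v carrying a feature vector x_v ∈ ℝ^d. Let Ã ∈ ℝ^{n×n} be a matrix with nonnegative entries whose rows each sum to 1, and define the embedding h_v = Σ_{u∈V} Ã[v,u] x_u for each node v. Let W ∈ ℝ^{d×c} be a matrix with spectral norm ‖W‖₂, and let p_v = Wᵀ h_v be the logit of node v. Then the group-logit disparity satisfies ‖ (1/|V_a|) Σ_{v∈V_a} p_v − (1/|V_{≠a}|) Σ_{v∈V_{≠a}} p_v ‖₂ ≤ ‖W‖₂ · ( |β[a,a] − β[≠a,a]| · ‖μ_a − μ_{≠a}‖₂ + 2√d · δ_a ), where μ_a and μ_{≠a} are the means of the feature vectors over V_a and V_{≠a}, β[a,a] = (1/|V_a|) Σ_{i∈V_a, j∈V_a} Ã[i,j], β[≠a,a] = (1/|V_{≠a}|) Σ_{i∈V_{≠a}, j∈V_a} Ã[i,j], and δ_a = max( max_{v∈V_a} ‖x_v − μ_a‖_∞ , max_{v∈V_{≠a}}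 ‖x_v − μ_{≠a}‖_∞ ). -/
open Finset

/-- The Euclidean (ℓ²) norm of a vector in ℝ^d. -/
noncomputable def norm2 {d : ℕ} (v : Fin d → ℝ) : ℝ :=
  Real.sqrt (∑ i, v i ^ 2)

/-- The sup (ℓ^∞) norm of a vector in ℝ^d (the `Pi` norm on `Fin d → ℝ`
is the sup norm). -/
noncomputable def normInf {d : ℕ} (v : Fin d → ℝ) : ℝ := ‖v‖

/-- The spectral (operator ℓ²→ℓ²) norm of a matrix `W ∈ ℝ^{d×c}`. -/
noncomputable def specNorm {d c : ℕ} (W : Matrix (Fin d) (Fin c) ℝ) : ℝ :=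
  ‖LinearMap.toContinuousLinearMap (Matrix.toEuclideanLin W)‖

lemma norm2_eq {d : ℕ} (v : Fin d → ℝ) : norm2 v = ‖WithLp.toLp 2 v‖ := by
  simp [norm2, EuclideanSpace.norm_eq]

open scoped Matrix.Norms.L2Operator in
lemma norm2_mulVec_le {d c : ℕ} (W : Matrix (Fin d) (Fin c) ℝ) (y : Fin d → ℝ) :
    norm2 (W.transpose.mulVec y) ≤ specNorm W * norm2 y := by
  have h1 := Matrix.l2_opNorm_mulVec (W.conjTranspose) (WithLp.toLp 2 y)
  rw [Matrix.l2_opNorm_conjTranspose, Matrix.conjTranspose_eq_transpose_of_trivial] at h1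
  rw [norm2_eq, norm2_eq]
  exact h1

lemma norm2_add_le {d : ℕ} (v w : Fin d → ℝ) : norm2 (v + w) ≤ norm2 v + norm2 w := by
  simp only [norm2_eq, WithLp.toLp_add]
  exact norm_add_le _ _

lemma norm2_smul_eq {d : ℕ} (a : ℝ) (v : Fin d → ℝ) : norm2 (a • v) = |a| * norm2 v := by
  simp only [norm2_eq, WithLp.toLp_smul, norm_smul, Real.norm_eq_abs]

lemma norm2_le_of_abs {d : ℕ} (v : Fin d → ℝ) (b : ℝ) (hb : 0 ≤ b) (hv : ∀ i, |v i| ≤ b) :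
    norm2 v ≤ Real.sqrt d * b := by
  have h1 : ∑ i, v i ^ 2 ≤ d * b ^ 2 := by
    calc ∑ i, v i ^ 2 ≤ ∑ _i : Fin d, b ^ 2 :=
          Finset.sum_le_sum fun i _ => sq_le_sq' (neg_le_of_abs_le (hv i)) (le_of_abs_le (hv i))
      _ = d * b ^ 2 := by simp
  calc norm2 v ≤ Real.sqrt (d * b ^ 2) := Real.sqrt_le_sqrt h1
    _ = Real.sqrt d * b := by rw [Real.sqrt_mul (by positivity), Real.sqrt_sq hb]

lemma avg_bound {ι : Type*} (T : Finset ι) (hT : T.Nonempty) (f : ι → ℝ) (δ : ℝ)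
    (hf : ∀ v ∈ T, |f v| ≤ δ) : |(T.card : ℝ)⁻¹ * ∑ v ∈ T, f v| ≤ δ := by
  have hc : (0 : ℝ) < T.card := by exact_mod_cast hT.card_pos
  rw [abs_mul, abs_of_pos (inv_pos.2 hc), inv_mul_le_iff₀ hc]
  calc |∑ v ∈ T, f v| ≤ ∑ v ∈ T, |f v| := Finset.abs_sum_le_sum_abs _ _
    _ ≤ ∑ _v ∈ T, δ := Finset.sum_le_sum hf
    _ = T.card * δ := by simp

lemma row_bound {n : ℕ} (S : Finset (Fin n)) (w f : Fin n → ℝ) (hw : ∀ j, 0 ≤ w j)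
    (hw1 : ∑ j, w j = 1) (a b δ : ℝ) (ha : ∀ u ∈ S, |f u - a| ≤ δ)
    (hb : ∀ u ∈ Sᶜ, |f u - b| ≤ δ) :
    |∑ u, w u * f u - ((∑ j ∈ S, w j) * (a - b) + b)| ≤ δ := by
  have e : ∑ u, w u * f u - ((∑ j ∈ S, w j) * (a - b) + b)
      = ∑ u ∈ S, w u * (f u - a) + ∑ u ∈ Sᶜ, w u * (f u - b) := by
    have h2 := Finset.sum_add_sum_compl S w
    have h3 := Finset.sum_add_sum_compl S (fun u => w u * f u)
    simp only [mul_sub, Finset.sum_sub_distrib, ← Finset.sum_mul]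
    rw [hw1] at h2
    rw [← h3]
    linear_combination b * h2
  rw [e]
  have key : ∀ (T : Finset (Fin n)) (t : ℝ), (∀ u ∈ T, |f u - t| ≤ δ) →
      |∑ u ∈ T, w u * (f u - t)| ≤ (∑ u ∈ T, w u) * δ := by
    intro T t ht
    rw [Finset.sum_mul]
    refine (Finset.abs_sum_le_sum_abs _ _).trans (Finset.sum_le_sum fun u hu => ?_)
    rw [abs_mul, abs_of_nonneg (hw u)]
    exact mul_le_mul_of_nonneg_left (ht u hu) (hw u)
  calc _ ≤ _ := abs_add_le _ _
    _ ≤ (∑ u ∈ S, w u) * δ + (∑ u ∈ Sᶜ, w u) * δ := add_le_add (key S a ha) (key _ b hb)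
    _ = δ := by rw [← add_mul, Finset.sum_add_sum_compl, hw1, one_mul]

/-- Per-sensitive-value bound inside Theorem 1 of FairSample. -/
theorem stmt0 (n d c : ℕ) (x : Fin n → Fin d → ℝ)
    (S : Finset (Fin n)) (hS : S.Nonempty) (hSc : Sᶜ.Nonempty)
    (A : Matrix (Fin n) (Fin n) ℝ)
    (hA0 : ∀ i j, 0 ≤ A i j) (hA1 : ∀ i, ∑ j, A i j = 1)
    (W : Matrix (Fin d) (Fin c) ℝ)
    (h : Fin n → Fin d → ℝ) (hh : ∀ v, h v = ∑ u, A v u • x u)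
    (p : Fin n → Fin c → ℝ) (hp : ∀ v, p v = (Matrix.transpose W).mulVec (h v))
    (μa μc : Fin d → ℝ)
    (hμa : μa = (S.card : ℝ)⁻¹ • ∑ v ∈ S, x v)
    (hμc : μc = (Sᶜ.card : ℝ)⁻¹ • ∑ v ∈ Sᶜ, x v)
    (βaa βca : ℝ)
    (hβaa : βaa = (S.card : ℝ)⁻¹ * ∑ i ∈ S, ∑ j ∈ S, A i j)
    (hβca : βca = (Sᶜ.card : ℝ)⁻¹ * ∑ i ∈ Sᶜ, ∑ j ∈ S, A i j)
    (δ : ℝ)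
    (hδ : δ = max (S.sup' hS fun v => normInf (x v - μa))
                  (Sᶜ.sup' hSc fun v => normInf (x v - μc))) :
    norm2 ((S.card : ℝ)⁻¹ • ∑ v ∈ S, p v - (Sᶜ.card : ℝ)⁻¹ • ∑ v ∈ Sᶜ, p v)
      ≤ specNorm W * (|βaa - βca| * norm2 (μa - μc) + 2 * Real.sqrt d * δ) := by
  have hxa : ∀ u ∈ S, ∀ i, |x u i - μa i| ≤ δ := by
    intro u hu i
    rw [hδ]
    refine le_trans ?_ (le_max_left _ _)
    refine le_trans ?_ (Finset.le_sup' (fun v => normInf (x v - μa)) hu)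
    exact norm_le_pi_norm (x u - μa) i
  have hxc : ∀ u ∈ Sᶜ, ∀ i, |x u i - μc i| ≤ δ := by
    intro u hu i
    rw [hδ]
    refine le_trans ?_ (le_max_right _ _)
    refine le_trans ?_ (Finset.le_sup' (fun v => normInf (x v - μc)) hu)
    exact norm_le_pi_norm (x u - μc) i
  have hδ0 : 0 ≤ δ := by
    obtain ⟨u, hu⟩ := hS
    rw [hδ]
    refine le_trans ?_ (le_max_left _ _)
    refine le_trans ?_ (Finset.le_sup' (fun v => normInf (x v - μa)) hu)
    exact norm_nonneg _
  have avg : ∀ T : Finset (Fin n), T.Nonempty → ∀ i,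
      |(T.card : ℝ)⁻¹ * ∑ v ∈ T, h v i
        - (((T.card : ℝ)⁻¹ * ∑ v ∈ T, ∑ j ∈ S, A v j) * (μa i - μc i) + μc i)| ≤ δ := by
    intro T hT i
    have h1 := avg_bound T hT
      (fun v => h v i - ((∑ j ∈ S, A v j) * (μa i - μc i) + μc i)) δ (by
        intro v _
        have h2 := row_bound S (A v) (fun u => x u i) (hA0 v) (hA1 v) (μa i) (μc i) δ
          (fun u hu => hxa u hu i) (fun u hu => hxc u hu i)
        have h3 : h v i = ∑ u, A v u * x u i := by simp [hh v, Finset.sum_apply]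
        rw [h3]
        exact h2)
    have hc : (T.card : ℝ) ≠ 0 := by exact_mod_cast hT.card_pos.ne'
    convert h1 using 2
    rw [Finset.sum_sub_distrib, Finset.sum_add_distrib, ← Finset.sum_mul, Finset.sum_const,
      nsmul_eq_mul]
    field_simp
  set y : Fin d → ℝ := (S.card : ℝ)⁻¹ • ∑ v ∈ S, h v - (Sᶜ.card : ℝ)⁻¹ • ∑ v ∈ Sᶜ, h v with hy
  have hpy : (S.card : ℝ)⁻¹ • ∑ v ∈ S, p v - (Sᶜ.card : ℝ)⁻¹ • ∑ v ∈ Sᶜ, p v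
      = W.transpose.mulVec y := by
    simp only [hy, hp, Matrix.mulVec_sub, Matrix.mulVec_smul, Matrix.mulVec_sum]
  rw [hpy]
  refine (norm2_mulVec_le W y).trans (mul_le_mul_of_nonneg_left ?_ (norm_nonneg _))
  have hsplit : y = (βaa - βca) • (μa - μc) + (y - (βaa - βca) • (μa - μc)) := by abel
  rw [hsplit]
  refine (norm2_add_le _ _).trans ?_
  rw [norm2_smul_eq]
  refine add_le_add le_rfl ?_
  have hfin := norm2_le_of_abs (y - (βaa - βca) • (μa - μc)) (2 * δ) (by linarith) (by
    intro i
    have h1 := abs_le.1 (avg S hS i)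
    have h2 := abs_le.1 (avg Sᶜ hSc i)
    rw [← hβaa] at h1
    rw [← hβca] at h2
    have h3 : (y - (βaa - βca) • (μa - μc)) i = (S.card : ℝ)⁻¹ * ∑ v ∈ S, h v i
        - (Sᶜ.card : ℝ)⁻¹ * ∑ v ∈ Sᶜ, h v i - (βaa - βca) * (μa i - μc i) := by
      simp [hy, Finset.sum_apply]
    rw [h3, abs_le]
    constructor <;> nlinarith [h1.1, h1.2, h2.1, h2.2])
  linarith
end

section
/- Let V be a finite set of n nodes partitioned into two nonempty groups V_a and V_{≠a}, each node v carrying a feature vector x_v ∈ ℝ^d. Let Ã ∈ ℝ^{n×n} be a matrix with nonnegative entries whose rows each sum to 1, and let h_v = Σ_{u∈V} Ã[v,u] x_u. Then the mean embedding over V_a satisfies ‖ (1/|V_a|) Σ_{v∈V_a} h_v − ( β[a,a] · μ_a + β[a,≠a] · μ_{≠a} ) ‖_∞ ≤ δ_a, where β[a,a] = (1/|V_a|) Σ_{i∈V_a, j∈V_a} Ã[i,j], β[a,≠a] = (1/|V_a|) Σ_{i∈V_a, j∈V_{≠a}} Ã[i,j], μ_a and μ_{≠a} are the means of the feature vectors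 over V_a and V_{≠a}, and δ_a = max( max_{v∈V_a} ‖x_v − μ_a‖_∞ , max_{v∈V_{≠a}} ‖x_v − μ_{≠a}‖_∞ ). -/
open Finset

/-- Intermediate claim in the proof of Theorem 1 of FairSample: the average SGCN
embedding of a sensitive group lies coordinatewise within `δ` of the β-weighted
combination of the two group means. -/
theorem stmt3 (n d : ℕ) (x : Fin n → Fin d → ℝ)
    (S : Finset (Fin n)) (hS : S.Nonempty) (hSc : Sᶜ.Nonempty)
    (A : Matrix (Fin n) (Fin n) ℝ)
    (hA0 : ∀ i j, 0 ≤ A i j) (hA1 : ∀ i, ∑ j, A i j = 1)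
    (h : Fin n → Fin d → ℝ) (hh : ∀ v, h v = ∑ u, A v u • x u)
    (μa μc : Fin d → ℝ)
    (hμa : μa = (S.card : ℝ)⁻¹ • ∑ v ∈ S, x v)
    (hμc : μc = (Sᶜ.card : ℝ)⁻¹ • ∑ v ∈ Sᶜ, x v)
    (βaa βac : ℝ)
    (hβaa : βaa = (S.card : ℝ)⁻¹ * ∑ i ∈ S, ∑ j ∈ S, A i j)
    (hβac : βac = (S.card : ℝ)⁻¹ * ∑ i ∈ S, ∑ j ∈ Sᶜ, A i j)
    (δ : ℝ)
    (hδ : δ = max (S.sup' hS fun v => normInf (x v - μa))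
                  (Sᶜ.sup' hSc fun v => normInf (x v - μc))) :
    normInf ((S.card : ℝ)⁻¹ • ∑ v ∈ S, h v - (βaa • μa + βac • μc)) ≤ δ := by
  have hb1 : ∀ u ∈ S, ‖x u - μa‖ ≤ δ := by
    intro u hu
    rw [hδ]
    exact le_max_of_le_left (Finset.le_sup' (fun v => normInf (x v - μa)) hu)
  have hb2 : ∀ u ∈ Sᶜ, ‖x u - μc‖ ≤ δ := by
    intro u hu
    rw [hδ]
    exact le_max_of_le_right (Finset.le_sup' (fun v => normInf (x v - μc)) hu)
  have hc : (0 : ℝ) < S.card := by exact_mod_cast hS.card_pos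
  clear hμa hμc hδ
  have key : (S.card : ℝ)⁻¹ • ∑ v ∈ S, h v - (βaa • μa + βac • μc)
      = (S.card : ℝ)⁻¹ • ∑ v ∈ S,
        (∑ u ∈ S, A v u • (x u - μa) + ∑ u ∈ Sᶜ, A v u • (x u - μc)) := by
    have e : ∀ v, h v = ∑ u ∈ S, A v u • x u + ∑ u ∈ Sᶜ, A v u • x u := by
      intro v
      rw [hh, Finset.sum_add_sum_compl]
    simp only [e, hβaa, hβac, mul_smul, smul_sub, Finset.sum_sub_distrib,
      Finset.sum_add_distrib, Finset.sum_smul, smul_add]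
    abel
  unfold normInf
  rw [key, norm_smul, norm_inv, Real.norm_of_nonneg hc.le, inv_mul_le_iff₀ hc,
    ← nsmul_eq_mul]
  refine (norm_sum_le _ _).trans (Finset.sum_le_card_nsmul _ _ _ fun v _ => ?_)
  have b : ∀ (T : Finset (Fin n)) (m : Fin d → ℝ), (∀ u ∈ T, ‖x u - m‖ ≤ δ) →
      ‖∑ u ∈ T, A v u • (x u - m)‖ ≤ (∑ u ∈ T, A v u) * δ := by
    intro T m hT
    rw [Finset.sum_mul]
    refine norm_sum_le_of_le _ fun u hu => ?_
    rw [norm_smul, Real.norm_of_nonneg (hA0 v u)]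
    exact mul_le_mul_of_nonneg_left (hT u hu) (hA0 v u)
  calc _ ≤ _ := norm_add_le _ _
    _ ≤ (∑ u ∈ S, A v u) * δ + (∑ u ∈ Sᶜ, A v u) * δ := add_le_add (b _ _ hb1) (b _ _ hb2)
    _ = δ := by rw [← add_mul, Finset.sum_add_sum_compl, hA1, one_mul]
end

section
/- Let V be a finite set of n nodes partitioned into two nonempty groups V_a and V_{≠a}, each node v carrying a feature vector x_v ∈ ℝ^d. Let Ã ∈ ℝ^{n×n} be a matrix with nonnegative entries whose rows each sum to 1, and let h_v = Σ_{u∈V} Ã[v,u] x_u. Then the difference of the group mean embeddings satisfies ‖ (1/|V_a|) Σ_{v∈V_a} h_v − (1/|V_{≠a}|) Σ_{v∈V_{≠a}} h_v − ( β[a,a] − β[≠a,a] ) · ( μ_a − μ_{≠a} ) ‖_∞ ≤ 2δ_a, where β[a,a] = (1/|V_a|) Σ_{i∈V_a, j∈V_a} Ã[i,j], β[≠a,a] = (1/|V_{≠a}|) Σ_{i∈V_{≠a}, j∈V_a} Ã[i,j], μ_a and μ_{≠a} are the means of the feature vectors over V_a and V_{≠a}, and δ_a = max( max_{v∈V_a}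 ‖x_v − μ_a‖_∞ , max_{v∈V_{≠a}} ‖x_v − μ_{≠a}‖_∞ ). -/
open Finset

theorem stmt5_group {n d : ℕ} (x : Fin n → Fin d → ℝ) (S T : Finset (Fin n)) (hT : T.Nonempty)
    (A : Matrix (Fin n) (Fin n) ℝ)
    (hA0 : ∀ i j, 0 ≤ A i j) (hA1 : ∀ i, ∑ j, A i j = 1)
    (h : Fin n → Fin d → ℝ) (hh : ∀ v, h v = ∑ u, A v u • x u)
    (p q : Fin d → ℝ) (δ : ℝ) (h1 : ∀ u ∈ S, ‖x u - p‖ ≤ δ) (h2 : ∀ u ∈ Sᶜ, ‖x u - q‖ ≤ δ) (b : ℝ)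
    (hb : b = (T.card : ℝ)⁻¹ * ∑ i ∈ T, ∑ j ∈ S, A i j) :
    ‖(T.card : ℝ)⁻¹ • ∑ v ∈ T, h v - (b • (p - q) + q)‖ ≤ δ := by
  have hc : (0 : ℝ) < T.card := by exact_mod_cast hT.card_pos
  have key : ∀ v, ‖h v - ((∑ j ∈ S, A v j) • (p - q) + q)‖ ≤ δ := by
    intro v
    have e : h v - ((∑ j ∈ S, A v j) • (p - q) + q)
        = ∑ u, A v u • (x u - if u ∈ S then p else q) := by
      have hs := hA1 v
      rw [← Finset.sum_add_sum_compl S] at hs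
      have hs' : ∑ u ∈ Sᶜ, A v u = 1 - ∑ u ∈ S, A v u := by linarith
      have e1 : ∑ u, A v u • (if u ∈ S then p else q)
          = (∑ u ∈ S, A v u) • p + (∑ u ∈ Sᶜ, A v u) • q := by
        rw [← Finset.sum_add_sum_compl S, Finset.sum_smul, Finset.sum_smul]
        congr 1
        · exact Finset.sum_congr rfl fun u hu => by rw [if_pos hu]
        · exact Finset.sum_congr rfl fun u hu => by rw [if_neg (Finset.mem_compl.mp hu)]
      simp only [smul_sub, Finset.sum_sub_distrib]
      rw [e1, hs', hh]
      module
    rw [e]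
    calc _ ≤ ∑ u, A v u * δ := by
          refine norm_sum_le_of_le _ fun u _ => ?_
          rw [norm_smul, Real.norm_of_nonneg (hA0 v u)]
          refine mul_le_mul_of_nonneg_left ?_ (hA0 v u)
          by_cases hu : u ∈ S
          · rw [if_pos hu]; exact h1 u hu
          · rw [if_neg hu]; exact h2 u (Finset.mem_compl.mpr hu)
      _ = δ := by rw [← Finset.sum_mul, hA1, one_mul]
  have e : (T.card : ℝ)⁻¹ • ∑ v ∈ T, h v - (b • (p - q) + q)
      = (T.card : ℝ)⁻¹ • ∑ v ∈ T, (h v - ((∑ j ∈ S, A v j) • (p - q) + q)) := by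
    rw [Finset.sum_sub_distrib, Finset.sum_add_distrib, ← Finset.sum_smul, Finset.sum_const,
      ← Nat.cast_smul_eq_nsmul ℝ, smul_sub (T.card : ℝ)⁻¹, smul_add, smul_smul, smul_smul,
      inv_mul_cancel₀ hc.ne', one_smul, hb]
  rw [e, norm_smul, Real.norm_of_nonneg (inv_nonneg.mpr hc.le), inv_mul_le_iff₀ hc]
  refine (norm_sum_le_of_le _ fun v _ => key v).trans ?_
  simp

/-- Intermediate claim in the proof of Theorem 1 of FairSample: the difference of the
group mean SGCN embeddings lies coordinatewise within `2δ` of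
`(β[a,a] − β[≠a,a])·(μ_a − μ_{≠a})`. -/
theorem stmt5 (n d : ℕ) (x : Fin n → Fin d → ℝ)
    (S : Finset (Fin n)) (hS : S.Nonempty) (hSc : Sᶜ.Nonempty)
    (A : Matrix (Fin n) (Fin n) ℝ)
    (hA0 : ∀ i j, 0 ≤ A i j) (hA1 : ∀ i, ∑ j, A i j = 1)
    (h : Fin n → Fin d → ℝ) (hh : ∀ v, h v = ∑ u, A v u • x u)
    (μa μc : Fin d → ℝ)
    (hμa : μa = (S.card : ℝ)⁻¹ • ∑ v ∈ S, x v)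
    (hμc : μc = (Sᶜ.card : ℝ)⁻¹ • ∑ v ∈ Sᶜ, x v)
    (βaa βca : ℝ)
    (hβaa : βaa = (S.card : ℝ)⁻¹ * ∑ i ∈ S, ∑ j ∈ S, A i j)
    (hβca : βca = (Sᶜ.card : ℝ)⁻¹ * ∑ i ∈ Sᶜ, ∑ j ∈ S, A i j)
    (δ : ℝ)
    (hδ : δ = max (S.sup' hS fun v => normInf (x v - μa))
                  (Sᶜ.sup' hSc fun v => normInf (x v - μc))) :
    normInf ((S.card : ℝ)⁻¹ • ∑ v ∈ S, h v - (Sᶜ.card : ℝ)⁻¹ • ∑ v ∈ Sᶜ, h v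
        - (βaa - βca) • (μa - μc)) ≤ 2 * δ := by
  have h1 : ∀ u ∈ S, ‖x u - μa‖ ≤ δ := fun u hu => by
    rw [hδ]
    exact le_max_of_le_left (Finset.le_sup' (fun v => normInf (x v - μa)) hu)
  have h2 : ∀ u ∈ Sᶜ, ‖x u - μc‖ ≤ δ := fun u hu => by
    rw [hδ]
    exact le_max_of_le_right (Finset.le_sup' (fun v => normInf (x v - μc)) hu)
  have k1 := stmt5_group x S S hS A hA0 hA1 h hh μa μc δ h1 h2 βaa hβaa
  have k2 := stmt5_group x S Sᶜ hSc A hA0 hA1 h hh μa μc δ h1 h2 βca hβca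
  have k := (norm_sub_le _ _).trans (add_le_add k1 k2)
  unfold normInf
  rw [two_mul]
  refine le_trans (le_of_eq ?_) k
  congr 1
  module
end
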